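/- There is a computable G_δ set G ⊆ 2^ω such that no computable F_σ set F ⊆ 2^ω satisfies μ(F) = μ(G). -/

import Mathlib

open MeasureTheory Filter

namespace LMD

/-- The open subset of Cantor space generated by a set of finite binary strings. -/
def Cyl (W : Set (List Bool)) : Set (ℕ → Bool) :=
  {X | ∃ σ ∈ W, ∀ i : Fin σ.length, X i = σ.get i}

/-- The fair-coin product measure on Cantor space, realized as the pushforward of
Lebesgue measure on `[0,1)` under the binary expansion map. -/
noncomputable def mu : Measure (ℕ → Bool) :=
  Measure.map (fun x n => decide (⌊x * 2 ^ (n + 1)⌋₊ % 2 = 1))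
    (volume.restrict (Set.Ico (0 : ℝ) 1))

/-- `W` codes a computable `G_δ` set: the relation `σ ∈ W k` is computable in `(k, σ)`. -/
def ComputableCode (W : ℕ → Set (List Bool)) : Prop :=
  ∃ g : ℕ → List Bool → Bool, Computable₂ g ∧ ∀ (k : ℕ) (σ : List Bool), σ ∈ W k ↔ g k σ = true

open Topology

section Computability

variable {α : Type*} [Primcodable α]

theorem computable_nat_count {p : α → ℕ → Bool} (hp : Computable₂ p) :
    Computable₂ fun a n => Nat.count (fun i => p a i = true) n := by
  have h : Computable fun x : α × ℕ => Nat.rec (motive := fun _ => ℕ) 0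
      (fun y IH => IH + cond (p x.1 y) 1 0) x.2 := by
    refine Computable.nat_rec (f := fun x : α × ℕ => x.2) (g := fun _ => 0)
      (h := fun x yi => yi.2 + cond (p x.1 yi.1) 1 0) Computable.snd (Computable.const 0) ?_
    have hc : Computable fun z : (α × ℕ) × ℕ × ℕ => cond (p z.1.1 z.2.1) 1 0 :=
      Computable.cond (hp.comp (Computable.fst.comp Computable.fst)
        (Computable.fst.comp Computable.snd)) (Computable.const 1) (Computable.const 0)
    exact (Primrec.nat_add.to_comp.comp (Computable.snd.comp Computable.snd) hc).to₂
  refine h.of_eq fun x => ?_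
  induction x.2 with
  | zero => simp
  | succ n ih => simp only [Nat.count_succ, ih]; cases p x.1 n <;> simp

theorem computable_bounded_exists {p : α → ℕ → Bool} (hp : Computable₂ p) :
    Computable₂ fun a n => decide (∃ i < n, p a i = true) := by
  have h : Computable fun x : α × ℕ => decide (0 < Nat.count (fun i => p x.1 i = true) x.2) :=
    Computable₂.comp (Primrec₂.to_comp Primrec.nat_lt.decide) (Computable.const 0) (computable_nat_count hp)
  refine h.of_eq fun x => ?_
  simp only [Nat.count_eq_card_filter_range, Finset.card_pos,
    Finset.filter_nonempty_iff, Finset.mem_range]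

theorem computable_bounded_forall {p : α → ℕ → Bool} (hp : Computable₂ p) :
    Computable₂ fun a n => decide (∀ i < n, p a i = true) := by
  have h := Primrec.not.to_comp.comp (computable_bounded_exists
    (p := fun a i => !p a i) (Primrec.not.to_comp.comp hp))
  refine h.of_eq fun x => ?_
  rw [← decide_not, decide_eq_decide]
  simp

/-- The list of the `l` lowest binary digits of `y`, most significant digit first. -/
def bits (l y : ℕ) : List Bool :=
  (List.range l).map fun i => decide (y / 2 ^ (l - 1 - i) % 2 = 1)

theorem primrec_two_pow : Primrec fun n : ℕ => 2 ^ n :=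
  (Primrec.nat_iff.2 ((Nat.Primrec.pow.comp
    ((Nat.Primrec.const 2).pair Nat.Primrec.id)).of_eq fun n => by simp))

theorem computable_bits : Computable₂ bits := by
  refine Primrec₂.to_comp ?_
  refine Primrec.list_map (Primrec.list_range.comp Primrec.fst) ?_
  refine Primrec.eq.decide.comp (Primrec.nat_mod.comp (Primrec.nat_div.comp
    (Primrec.snd.comp Primrec.fst) (primrec_two_pow.comp ?_)) (Primrec.const 2)) (Primrec.const 1)
  exact Primrec.nat_sub.comp (Primrec.nat_sub.comp (Primrec.fst.comp Primrec.fst)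
    (Primrec.const 1)) Primrec.snd

/-- The dyadic interval of level `s` and index `x` is caught, by strings of length at most `s`,
in each of the first `m + 1` open sets coded by `g`. -/
def Caught (g : ℕ → List Bool → Bool) (m s x : ℕ) : Prop :=
  ∀ k < m + 1, ∃ l < s + 1, g k (bits l (x / 2 ^ (s - l))) = true

instance (g : ℕ → List Bool → Bool) (m s : ℕ) : DecidablePred (Caught g m s) :=
  fun x => inferInstanceAs
    (Decidable (∀ k < m + 1, ∃ l < s + 1, g k (bits l (x / 2 ^ (s - l))) = true))

/-- The number of dyadic intervals of level `s` that are caught. -/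
def caughtCount (g : ℕ → List Bool → Bool) (m s : ℕ) : ℕ :=
  Nat.count (Caught g m s) (2 ^ s)

theorem computable_caughtCount {g : ℕ → List Bool → Bool} (hg : Computable₂ g) :
    Computable₂ (caughtCount g) := by
  have h₁ : Computable₂ fun (a : (ℕ × ℕ) × ℕ) (l : ℕ) =>
      g a.2 (bits l (a.1.2 / 2 ^ (a.1.1 - l))) := by
    refine (hg.comp (Computable.snd.comp Computable.fst) (computable_bits.comp Computable.snd
      (Primrec.nat_div.to_comp.comp (Computable.snd.comp (Computable.fst.comp Computable.fst))
      (primrec_two_pow.to_comp.comp (Primrec.nat_sub.to_comp.comp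
        (Computable.fst.comp (Computable.fst.comp Computable.fst)) Computable.snd))))).to₂
  have h₂ : Computable₂ fun (a : ℕ × ℕ) (k : ℕ) =>
      decide (∃ l < a.1 + 1, g k (bits l (a.2 / 2 ^ (a.1 - l))) = true) :=
    ((computable_bounded_exists h₁).comp Computable.id
      (Computable.succ.comp (Computable.fst.comp Computable.fst))).to₂
  have h₃ : Computable₂ fun (a : ℕ × ℕ) (x : ℕ) => decide (Caught g a.1 a.2 x) := by
    have := ((computable_bounded_forall h₂).comp (Computable.pair
      (Computable.snd.comp Computable.fst) Computable.snd)
      (Computable.succ.comp (Computable.fst.comp Computable.fst)) : Computable fun x : (ℕ × ℕ) × ℕ =>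
        _)
    refine this.of_eq fun x => ?_
    simp only [Caught, decide_eq_true_eq, Nat.succ_eq_add_one]
    congr
  have h₄ := (computable_nat_count h₃).comp Computable.id
    (primrec_two_pow.to_comp.comp Computable.snd)
  refine h₄.of_eq fun x => ?_
  simp [caughtCount]

/-- Within `t` steps, the `n`-th program halts on `(n, k)`. -/
def haltsWithin (t n k : ℕ) : Bool :=
  (Nat.Partrec.Code.evaln t (Denumerable.ofNat Nat.Partrec.Code n) (Nat.pair n k)).isSome

theorem computable_haltsWithin :
    Computable fun a : ℕ × ℕ × ℕ => haltsWithin a.1 a.2.1 a.2.2 := by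
  refine (Primrec.option_isSome.comp (Nat.Partrec.Code.primrec_evaln.comp
    (Primrec.pair (Primrec.pair Primrec.fst ((Primrec.ofNat _).comp
      (Primrec.fst.comp Primrec.snd))) ?_))).to_comp
  exact Primrec₂.natPair.comp (Primrec.fst.comp Primrec.snd) (Primrec.snd.comp Primrec.snd)

/-- The string `σ` starts with `n` zeros followed by a one. -/
def startsAt (σ : List Bool) (n : ℕ) : Bool :=
  decide (∀ i < n, decide (σ[i]? = some false) = true) && decide (σ[n]? = some true)

/-- Codes the open sets whose intersection consists of the sequences `0ⁿ1⋯` such that the `n`-th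
program halts on `(n, k)` for all `k`. -/
def haltCode (k : ℕ) (σ : List Bool) : Bool :=
  decide (∃ n < σ.length, (startsAt σ n && haltsWithin σ.length n k) = true)

theorem computable_startsAt : Computable₂ startsAt := by
  have h (b : Bool) : Computable₂ fun (a : List Bool) (i : ℕ) => decide (a[i]? = some b) :=
    (Primrec.eq.decide.comp Primrec.list_getElem? (Primrec.const (some b))).to_comp.to₂
  exact (Primrec.and.to_comp : Computable₂ and).comp (computable_bounded_forall (h false)) (h true)

theorem computable_haltCode : Computable₂ haltCode := by
  have h : Computable₂ fun (a : ℕ × List Bool) (n : ℕ) =>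
      startsAt a.2 n && haltsWithin a.2.length n a.1 := by
    have h₁ : Computable fun x : (ℕ × List Bool) × ℕ => startsAt x.1.2 x.2 :=
      computable_startsAt.comp (Computable.snd.comp Computable.fst) Computable.snd
    have h₂ : Computable fun x : (ℕ × List Bool) × ℕ => haltsWithin x.1.2.length x.2 x.1.1 :=
      computable_haltsWithin.comp (g := fun x : (ℕ × List Bool) × ℕ => (x.1.2.length, x.2, x.1.1))
        (Computable.pair (Computable.list_length.comp (Computable.snd.comp Computable.fst))
          (Computable.pair Computable.snd (Computable.fst.comp Computable.fst)))
    exact (Primrec.and.to_comp : Computable₂ and).comp h₁ h₂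
  exact (computable_bounded_exists h).comp Computable.id
    (Computable.list_length.comp Computable.snd)

end Computability

section CantorSpace

theorem mem_Cyl_iff {W : Set (List Bool)} {X : ℕ → Bool} :
    X ∈ Cyl W ↔ ∃ l, (List.range l).map X ∈ W := by
  constructor
  · rintro ⟨σ, hσ, h⟩
    refine ⟨σ.length, ?_⟩
    convert hσ
    refine List.ext_getElem (by simp) fun i h₁ h₂ => ?_
    simpa using h ⟨i, h₂⟩
  · rintro ⟨l, hl⟩
    exact ⟨_, hl, fun i => by simp⟩

theorem measurableSet_Cyl (W : Set (List Bool)) : MeasurableSet (Cyl W) := by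
  have : Cyl W = ⋃ σ ∈ W, ⋂ i : Fin σ.length, (fun X : ℕ → Bool => X i) ⁻¹' {σ.get i} := by
    ext X
    simp [Cyl]
  rw [this]
  exact MeasurableSet.biUnion W.to_countable fun σ _ => MeasurableSet.iInter fun i =>
    measurable_pi_apply _ (measurableSet_singleton _)

/-- The binary expansion of a real number in `[0, 1)`. -/
noncomputable def binaryExpansion (x : ℝ) (n : ℕ) : Bool :=
  decide (⌊x * 2 ^ (n + 1)⌋₊ % 2 = 1)

theorem measurable_binaryExpansion : Measurable binaryExpansion := by
  refine measurable_pi_iff.2 fun n => ?_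
  exact (Measurable.of_discrete (f := fun k : ℕ => decide (k % 2 = 1))).comp
    (Nat.measurable_floor.comp (measurable_id.mul_const _))

theorem mu_apply {S : Set (ℕ → Bool)} (hS : MeasurableSet S) :
    mu S = volume (binaryExpansion ⁻¹' S ∩ Set.Ico 0 1) := by
  change Measure.map binaryExpansion _ S = _
  rw [Measure.map_apply measurable_binaryExpansion hS,
    Measure.restrict_apply (measurable_binaryExpansion hS)]

instance : IsProbabilityMeasure mu := ⟨by rw [mu_apply MeasurableSet.univ]; simp⟩

theorem floor_mul_two_pow (r : ℝ) {l s : ℕ} (h : l ≤ s) :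
    ⌊r * 2 ^ l⌋₊ = ⌊r * 2 ^ s⌋₊ / 2 ^ (s - l) := by
  rw [← Nat.floor_div_natCast]
  congr 1
  push_cast
  rw [eq_div_iff (by positivity), mul_assoc, ← pow_add]
  congr 2
  omega

theorem map_binaryExpansion_range (r : ℝ) (l : ℕ) :
    (List.range l).map (binaryExpansion r) = bits l ⌊r * 2 ^ l⌋₊ := by
  refine List.map_congr_left fun i hi => ?_
  rw [List.mem_range] at hi
  rw [binaryExpansion, floor_mul_two_pow r (l := i + 1) (s := l) (by omega),
    show l - (i + 1) = l - 1 - i by omega]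

theorem volume_floor_mem (p : ℕ → Prop) [DecidablePred p] (s : ℕ) :
    volume.real ({r : ℝ | p ⌊r * 2 ^ s⌋₊} ∩ Set.Ico 0 1) = Nat.count p (2 ^ s) / 2 ^ s := by
  have hs : (0 : ℝ) < 2 ^ s := by positivity
  have key : {r : ℝ | p ⌊r * 2 ^ s⌋₊} ∩ Set.Ico 0 1 =
      ⋃ x ∈ (Finset.range (2 ^ s)).filter p,
        Set.Ico ((x : ℝ) / 2 ^ s) (((x : ℝ) + 1) / 2 ^ s) := by
    ext r
    simp only [Set.mem_inter_iff, Set.mem_ofPred_eq, Set.mem_Ico, Set.mem_iUnion,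
      Finset.mem_filter, Finset.mem_range, exists_prop, div_le_iff₀ hs, lt_div_iff₀ hs]
    constructor
    · rintro ⟨hp, h0, h1⟩
      have h0' : 0 ≤ r * 2 ^ s := by positivity
      refine ⟨_, ⟨?_, hp⟩, Nat.floor_le h0', Nat.lt_floor_add_one _⟩
      rw [Nat.floor_lt h0']
      push_cast
      nlinarith
    · rintro ⟨x, ⟨hx, hp⟩, h1, h2⟩
      have h0 : 0 ≤ r * 2 ^ s := le_trans (by positivity) h1
      refine ⟨by rwa [(Nat.floor_eq_iff h0).2 ⟨h1, h2⟩], nonneg_of_mul_nonneg_left h0 hs, ?_⟩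
      have : (x : ℝ) + 1 ≤ 2 ^ s := by exact_mod_cast hx
      by_contra! h
      nlinarith
  rw [key, measureReal_biUnion_finset (h := fun _ _ => measure_Ico_lt_top.ne), Nat.count_eq_card_filter_range]
  · simp only [Real.volume_real_Ico, div_sub_div_same, add_sub_cancel_left]
    rw [Finset.sum_const, max_eq_left (by positivity), nsmul_eq_mul, mul_one_div]
  · intro x _ y _ hxy
    refine Set.disjoint_left.2 fun r hx hy => hxy ?_
    simp only [Set.mem_Ico, div_le_iff₀ hs, lt_div_iff₀ hs] at hx hy
    have h0 : 0 ≤ r * 2 ^ s := le_trans (by positivity) hx.1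
    rw [← (Nat.floor_eq_iff h0).2 hx, (Nat.floor_eq_iff h0).2 hy]
  · exact fun _ _ => measurableSet_Ico

/-- The sequences that lie in each of the first `m + 1` open sets coded by `g`. -/
def openInter (g : ℕ → List Bool → Bool) (m : ℕ) : Set (ℕ → Bool) :=
  ⋂ k < m + 1, Cyl {σ | g k σ = true}

theorem measurableSet_openInter (g : ℕ → List Bool → Bool) (m : ℕ) :
    MeasurableSet (openInter g m) :=
  MeasurableSet.iInter fun _ => MeasurableSet.iInter fun _ => measurableSet_Cyl _

/-- The sequences caught in each of the first `m + 1` open sets coded by `g` by strings of length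
at most `s`. -/
def caughtSet (g : ℕ → List Bool → Bool) (m s : ℕ) : Set (ℕ → Bool) :=
  ⋂ k < m + 1, Cyl {σ | g k σ = true ∧ σ.length < s + 1}

theorem mem_caughtSet {g : ℕ → List Bool → Bool} {m s : ℕ} {X : ℕ → Bool} :
    X ∈ caughtSet g m s ↔ ∀ k < m + 1, ∃ l < s + 1, g k ((List.range l).map X) = true := by
  simp [caughtSet, mem_Cyl_iff, and_comm]

theorem mu_caughtSet (g : ℕ → List Bool → Bool) (m s : ℕ) :
    mu.real (caughtSet g m s) = caughtCount g m s / 2 ^ s := by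
  have hm : MeasurableSet (caughtSet g m s) :=
    MeasurableSet.iInter fun _ => MeasurableSet.iInter fun _ => measurableSet_Cyl _
  rw [Measure.real, mu_apply hm, caughtCount, ← volume_floor_mem, Measure.real]
  congr 3
  ext r
  simp only [Set.mem_preimage, mem_caughtSet, Set.mem_ofPred_eq, Caught, map_binaryExpansion_range]
  refine forall₂_congr fun k _ => exists_congr fun l => and_congr_right fun hl => ?_
  rw [floor_mul_two_pow r (Nat.lt_succ_iff.1 hl)]

theorem monotone_caughtSet (g : ℕ → List Bool → Bool) (m : ℕ) : Monotone (caughtSet g m) := by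
  intro s t hst X
  simp only [mem_caughtSet]
  intro h k hk
  obtain ⟨l, hl, hg⟩ := h k hk
  exact ⟨l, by omega, hg⟩

theorem iUnion_caughtSet (g : ℕ → List Bool → Bool) (m : ℕ) :
    ⋃ s, caughtSet g m s = openInter g m := by
  ext X
  simp only [Set.mem_iUnion, mem_caughtSet, openInter, Set.mem_iInter, mem_Cyl_iff,
    Set.mem_ofPred_eq]
  constructor
  · rintro ⟨s, h⟩ k hk
    obtain ⟨l, -, hg⟩ := h k hk
    exact ⟨l, hg⟩
  · intro h
    choose! l hl using h
    refine ⟨(Finset.range (m + 1)).sup l, fun k hk => ⟨l k, ?_, hl k hk⟩⟩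
    exact Nat.lt_succ_of_le (Finset.le_sup (Finset.mem_range.2 hk))

theorem tendsto_caughtCount (g : ℕ → List Bool → Bool) (m : ℕ) :
    Tendsto (fun s => (caughtCount g m s : ℝ) / 2 ^ s) atTop (𝓝 (mu.real (openInter g m))) := by
  simp only [← mu_caughtSet, ← iUnion_caughtSet]
  exact (ENNReal.tendsto_toReal (measure_ne_top _ _)).comp
    (tendsto_measure_iUnion_atTop (monotone_caughtSet g m))

theorem caughtCount_div_le (g : ℕ → List Bool → Bool) (m s : ℕ) :
    (caughtCount g m s : ℝ) / 2 ^ s ≤ mu.real (openInter g m) := by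
  rw [← mu_caughtSet, ← iUnion_caughtSet]
  exact measureReal_mono (Set.subset_iUnion _ s)

theorem iInter_openInter (g : ℕ → List Bool → Bool) :
    ⋂ m, openInter g m = ⋂ k, Cyl {σ | g k σ = true} := by
  ext X
  simp only [openInter, Set.mem_iInter]
  exact ⟨fun h k => h k k (Nat.lt_succ_self k), fun h _ k _ => h k⟩

theorem antitone_openInter (g : ℕ → List Bool → Bool) : Antitone (openInter g) := by
  intro m m' h X
  simp only [openInter, Set.mem_iInter]
  exact fun hX k hk => hX k (by omega)

theorem tendsto_openInter (g : ℕ → List Bool → Bool) :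
    Tendsto (fun m => mu.real (openInter g m)) atTop
      (𝓝 (mu.real (⋂ k, Cyl {σ | g k σ = true}))) := by
  rw [← iInter_openInter]
  exact (ENNReal.tendsto_toReal (measure_ne_top _ _)).comp
    (tendsto_measure_iInter_atTop (fun m => (measurableSet_openInter g m).nullMeasurableSet)
      (antitone_openInter g) ⟨0, measure_ne_top _ _⟩)

theorem le_mu_openInter (g : ℕ → List Bool → Bool) (m : ℕ) :
    mu.real (⋂ k, Cyl {σ | g k σ = true}) ≤ mu.real (openInter g m) := by
  rw [← iInter_openInter]
  exact measureReal_mono (Set.iInter_subset _ m)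

/-- The sequences starting with `n` zeros followed by a one. -/
def zerosOne (n : ℕ) : Set (ℕ → Bool) := {X | (∀ i < n, X i = false) ∧ X n = true}

theorem measurableSet_zerosOne (n : ℕ) : MeasurableSet (zerosOne n) := by
  have : zerosOne n = (⋂ i < n, (fun X : ℕ → Bool => X i) ⁻¹' {false}) ∩
      (fun X : ℕ → Bool => X n) ⁻¹' {true} := by
    ext X
    simp [zerosOne]
  rw [this]
  exact (MeasurableSet.iInter fun i => MeasurableSet.iInter fun _ => measurable_pi_apply _
    (measurableSet_singleton _)).inter (measurable_pi_apply _ (measurableSet_singleton _))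

theorem le_mu_zerosOne (n : ℕ) : 1 / 2 ^ (n + 1) ≤ mu.real (zerosOne n) := by
  have hn : (0 : ℝ) < 2 ^ (n + 1) := by positivity
  rw [Measure.real, mu_apply (measurableSet_zerosOne n), ← Measure.real]
  have hv : volume.real (Set.Ico ((1 : ℝ) / 2 ^ (n + 1)) (2 / 2 ^ (n + 1))) = 1 / 2 ^ (n + 1) := by
    rw [Real.volume_real_Ico, ← sub_div, max_eq_left (by norm_num)]
    norm_num
  rw [← hv]
  refine measureReal_mono ?_ (measure_ne_top_of_subset Set.inter_subset_right (by simp))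
  rintro r ⟨h1, h2⟩
  have hr : 0 ≤ r := le_trans (by positivity) h1
  rw [div_le_iff₀ hn] at h1
  rw [lt_div_iff₀ hn] at h2
  have hfl : ⌊r * 2 ^ (n + 1)⌋₊ = 1 := by
    rw [Nat.floor_eq_iff (by positivity)]
    norm_num
    exact ⟨h1, h2⟩
  refine ⟨⟨fun i hi => ?_, ?_⟩, hr, ?_⟩
  · rw [binaryExpansion, floor_mul_two_pow r (l := i + 1) (s := n + 1) (by omega), hfl,
      Nat.div_eq_of_lt (Nat.one_lt_two_pow (by omega))]
    simp
  · rw [binaryExpansion, hfl]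
    simp
  · have : (2 : ℝ) ≤ 2 ^ (n + 1) := by
      rw [pow_succ]
      linarith [one_le_pow₀ (n := n) (one_le_two : (1 : ℝ) ≤ 2)]
    by_contra! h
    nlinarith

theorem startsAt_map_range {X : ℕ → Bool} {l n : ℕ} :
    startsAt ((List.range l).map X) n = true ↔ n < l ∧ X ∈ zerosOne n := by
  simp only [startsAt, Bool.and_eq_true, decide_eq_true_eq, List.getElem?_map,
    Option.map_eq_some_iff, List.getElem?_eq_some_iff, List.length_range, List.getElem_range,
    zerosOne, Set.mem_ofPred_eq]
  constructor
  · rintro ⟨h, a, ⟨hn, rfl⟩, ha⟩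
    refine ⟨hn, fun i hi => ?_, ha⟩
    obtain ⟨b, ⟨_, rfl⟩, hb⟩ := h i hi
    exact hb
  · rintro ⟨hn, h, ha⟩
    exact ⟨fun i hi => ⟨i, ⟨by omega, rfl⟩, h i hi⟩, n, ⟨hn, rfl⟩, ha⟩

theorem eq_of_mem_zerosOne {X : ℕ → Bool} {n n' : ℕ} (h : X ∈ zerosOne n) (h' : X ∈ zerosOne n') :
    n = n' := by
  rcases lt_trichotomy n n' with hlt | heq | hlt
  · simpa [h.2] using h'.1 n hlt
  · exact heq
  · simpa [h'.2] using h.1 n' hlt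

theorem haltsWithin_mono {t t' n k : ℕ} (ht : t ≤ t') (h : haltsWithin t n k = true) :
    haltsWithin t' n k = true := by
  obtain ⟨x, hx⟩ := Option.isSome_iff_exists.1 h
  exact Option.isSome_iff_exists.2 ⟨x, Nat.Partrec.Code.evaln_mono ht hx⟩

theorem exists_haltsWithin_iff {n k : ℕ} : (∃ t, haltsWithin t n k = true) ↔
    ((Denumerable.ofNat Nat.Partrec.Code n).eval (Nat.pair n k)).Dom := by
  simp only [haltsWithin, Option.isSome_iff_exists, Part.dom_iff_mem]
  rw [exists_comm]
  exact exists_congr fun x => Nat.Partrec.Code.evaln_complete.symm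

theorem mem_Cyl_haltCode {X : ℕ → Bool} {n : ℕ} (hX : X ∈ zerosOne n) (k : ℕ) :
    X ∈ Cyl {σ | haltCode k σ = true} ↔ ∃ t, haltsWithin t n k = true := by
  simp only [mem_Cyl_iff, haltCode, Set.mem_ofPred_eq, decide_eq_true_eq, Bool.and_eq_true,
    startsAt_map_range, List.length_map, List.length_range]
  constructor
  · rintro ⟨l, n', -, ⟨-, hn'⟩, h⟩
    rw [eq_of_mem_zerosOne hX hn']
    exact ⟨l, h⟩
  · rintro ⟨t, ht⟩
    have hl : n < max t (n + 1) := by omega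
    exact ⟨max t (n + 1), n, hl, ⟨hl, hX⟩, haltsWithin_mono (le_max_left _ _) ht⟩

end CantorSpace

/-- Stage `s` refutes that the `n`-th program halts on `(n, k)` within `t` steps for all `k ≤ j`
while the measures of `openInter haltCode j` and `openInter f m` add up to at most
`1 + 2⁻⁽ⁿ⁺²⁾`. -/
def refutes (f : ℕ → List Bool → Bool) (n j m t s : ℕ) : Bool :=
  !decide (∀ k < j + 1, haltsWithin t n k = true) ||
    decide (2 ^ (n + 2) * 2 ^ s + 2 ^ s <
      2 ^ (n + 2) * (caughtCount haltCode j s + caughtCount f m s))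

theorem computable_refutes {f : ℕ → List Bool → Bool} (hf : Computable₂ f) :
    Computable₂ fun (x s : ℕ) => refutes f x.unpair.1 x.unpair.2.unpair.1
      x.unpair.2.unpair.2.unpair.1 x.unpair.2.unpair.2.unpair.2 s := by
  have u₁ {g : ℕ × ℕ → ℕ} (hg : Computable g) : Computable fun x => (g x).unpair.1 :=
    Computable.fst.comp (Computable.unpair.comp hg)
  have u₂ {g : ℕ × ℕ → ℕ} (hg : Computable g) : Computable fun x => (g x).unpair.2 :=
    Computable.snd.comp (Computable.unpair.comp hg)
  have hn := u₁ Computable.fst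
  have hj := u₁ (u₂ Computable.fst)
  have hm := u₁ (u₂ (u₂ Computable.fst))
  have ht := u₂ (u₂ (u₂ Computable.fst))
  have hs : Computable fun x : ℕ × ℕ => x.2 := Computable.snd
  have hh : Computable₂ fun (a : ℕ × ℕ) (k : ℕ) => haltsWithin a.1 a.2 k :=
    computable_haltsWithin.comp (g := fun x : (ℕ × ℕ) × ℕ => (x.1.1, x.1.2, x.2))
      (Computable.pair (Computable.fst.comp Computable.fst)
        (Computable.pair (Computable.snd.comp Computable.fst) Computable.snd))
  have hadd : Computable₂ fun a b : ℕ => a + b := Primrec.nat_add.to_comp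
  have hmul : Computable₂ fun a b : ℕ => a * b := Primrec.nat_mul.to_comp
  have hlt : Computable₂ fun a b : ℕ => decide (a < b) := Primrec₂.to_comp Primrec.nat_lt.decide
  have hpow : Computable fun n : ℕ => 2 ^ n := primrec_two_pow.to_comp
  have hn₂ := hpow.comp (Computable.succ.comp (Computable.succ.comp hn))
  have h₁ := Primrec.not.to_comp.comp ((computable_bounded_forall hh).comp (ht.pair hn)
    (Computable.succ.comp hj))
  have h₂ := hlt.comp (hadd.comp (hmul.comp hn₂ (hpow.comp hs)) (hpow.comp hs))
    (hmul.comp hn₂ (hadd.comp ((computable_caughtCount computable_haltCode).comp hj hs)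
      ((computable_caughtCount hf).comp hm hs)))
  exact (Primrec.or.to_comp : Computable₂ or).comp h₁ h₂

theorem forall_refutes_iff {f : ℕ → List Bool → Bool} {n j m t : ℕ} :
    (∀ s, refutes f n j m t s = false) ↔ (∀ k < j + 1, haltsWithin t n k = true) ∧
      mu.real (openInter haltCode j) + mu.real (openInter f m) ≤ 1 + 1 / 2 ^ (n + 2) := by
  have hb (s : ℕ) : (¬ 2 ^ (n + 2) * 2 ^ s + 2 ^ s <
      2 ^ (n + 2) * (caughtCount haltCode j s + caughtCount f m s)) ↔
      (caughtCount haltCode j s : ℝ) / 2 ^ s + (caughtCount f m s : ℝ) / 2 ^ s ≤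
        1 + 1 / 2 ^ (n + 2) := by
    rw [not_lt, ← Nat.cast_le (α := ℝ), ← add_div, div_le_iff₀ (by positivity),
      ← mul_le_mul_iff_right₀ (b := (caughtCount haltCode j s : ℝ) + _)
        (show (0 : ℝ) < 2 ^ (n + 2) by positivity)]
    push_cast
    refine iff_of_eq (congrArg _ ?_)
    field_simp
  simp only [refutes, Bool.or_eq_false_iff, Bool.not_eq_false', decide_eq_true_eq,
    decide_eq_false_iff_not, hb, forall_and, forall_const]
  refine and_congr_right fun _ => ⟨fun h => ?_, fun h s => ?_⟩
  · exact le_of_tendsto' ((tendsto_caughtCount _ _).add (tendsto_caughtCount _ _)) h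
  · exact (add_le_add (caughtCount_div_le _ _ _) (caughtCount_div_le _ _ _)).trans h

theorem mu_compl_add {f : ℕ → List Bool → Bool} :
    mu.real (⋃ k, (Cyl {σ | f k σ = true})ᶜ) + mu.real (⋂ k, Cyl {σ | f k σ = true}) = 1 := by
  rw [← Set.compl_iInter, add_comm,
    probReal_add_probReal_compl (MeasurableSet.iInter fun _ => measurableSet_Cyl _)]

/-- There is a computable `G_δ` set `G` such that no computable `F_σ` set has the same
measure as `G`. -/
theorem exists_Gdelta_no_Fsigma_same_measure :
    ∃ W : ℕ → Set (List Bool), ComputableCode W ∧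
      ¬ ∃ F : ℕ → Set (List Bool), ComputableCode F ∧
        mu (⋃ k, (Cyl (F k))ᶜ) = mu (⋂ k, Cyl (W k)) := by
  refine ⟨fun k => {σ | haltCode k σ = true}, ⟨haltCode, computable_haltCode, fun _ _ => Iff.rfl⟩,
    ?_⟩
  rintro ⟨F, ⟨f, hf, hF⟩, hμ⟩
  obtain rfl : F = fun k => {σ | f k σ = true} := funext fun k => Set.ext fun σ => hF k σ
  have hsum : mu.real (⋂ k, Cyl {σ | haltCode k σ = true}) +
      mu.real (⋂ k, Cyl {σ | f k σ = true}) = 1 := by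
    rw [← mu_compl_add (f := f), Measure.real, ← hμ]
    rfl
  obtain ⟨c, hc⟩ := Nat.Partrec.Code.exists_code.1
    (Partrec.nat_iff.1 (Partrec.rfind (computable_refutes hf).partrec₂))
  set n := Encodable.encode c with hn
  have hhalt (j m t : ℕ) : (∃ r, haltsWithin r n (Nat.pair j (Nat.pair m t)) = true) ↔
      ∃ s, refutes f n j m t s = true := by
    rw [exists_haltsWithin_iff, hn, Denumerable.ofNat_encode, hc, ← hn, Nat.rfind_dom]
    simp only [PFun.coe_val, Nat.unpair_pair, Part.mem_some_iff, Part.some_dom, implies_true,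
      and_true, eq_comm (a := true)]
  by_cases hA : ∀ k, ∃ t, haltsWithin t n k = true
  · have hlim : ∀ᶠ m in atTop, mu.real (openInter haltCode m) + mu.real (openInter f m) <
        1 + 1 / 2 ^ (n + 2) :=
      ((tendsto_openInter haltCode).add (tendsto_openInter f)).eventually_lt_const
        (by rw [hsum]; exact lt_add_of_pos_right _ (by positivity))
    obtain ⟨m, hm⟩ := hlim.exists
    choose t ht using hA
    let T := (Finset.range (m + 1)).sup t
    obtain ⟨s, hs⟩ := (hhalt m m T).1 ⟨_, ht _⟩
    have hnot := forall_refutes_iff.2 ⟨fun k hk => haltsWithin_mono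
      (Finset.le_sup (f := t) (Finset.mem_range.2 hk)) (ht k), hm.le⟩ s
    exact Bool.false_ne_true (hnot.symm.trans hs)
  · obtain ⟨k, hk⟩ := not_forall.1 hA
    have hdiv := hhalt k.unpair.1 k.unpair.2.unpair.1 k.unpair.2.unpair.2
    simp only [Nat.pair_unpair] at hdiv
    rw [hdiv] at hk
    simp only [not_exists, Bool.not_eq_true] at hk
    obtain ⟨ht, hle⟩ := forall_refutes_iff.1 hk
    set j := k.unpair.1
    have hdisj : Disjoint (⋂ k, Cyl {σ | haltCode k σ = true}) (zerosOne n) :=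
      Set.disjoint_left.2 fun X hX hX' => hA fun k =>
        (mem_Cyl_haltCode hX' k).1 (Set.mem_iInter.1 hX k)
    have hsub : (⋂ k, Cyl {σ | haltCode k σ = true}) ∪ zerosOne n ⊆ openInter haltCode j := by
      refine Set.union_subset ?_ fun X hX => ?_
      · rw [← iInter_openInter]
        exact Set.iInter_subset _ j
      · exact Set.mem_iInter₂.2 fun i hi => (mem_Cyl_haltCode hX i).2 ⟨_, ht i hi⟩
    have h₁ := measureReal_mono (μ := mu) hsub
    rw [measureReal_union hdisj (measurableSet_zerosOne n)] at h₁
    have h₂ := le_mu_zerosOne n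
    have h₃ := le_mu_openInter f k.unpair.2.unpair.1
    have h₄ : (1 : ℝ) / 2 ^ (n + 2) < 1 / 2 ^ (n + 1) :=
      one_div_lt_one_div_of_lt (by positivity) (pow_lt_pow_right₀ one_lt_two (by omega))
    linarith

end LMD
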